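/- arXiv:2201.09340 — 4 statements merged into one kernel-verified Lean document; each statement's English description precedes it below -/
import Mathlib

section
/- There is an absolute constant C > 0 such that the following holds. Let d ≥ 2 be an integer, let G be a finite simple graph admitting a coin model (c, r), and let ⪯ be a Koebe ordering of G with respect to (c, r). Then for every vertex u of G, |WReach_d[u]| ≤ C·d⁴·ln(d). -/
open Metric

/-- A coin model of a simple graph `G`: centers `c` and positive radii `r` such that the
open disks are pairwise disjoint and closed disks of adjacent vertices intersect. -/
structure IsCoinModel {V : Type*} (G : SimpleGraph V)
    (c : V → EuclideanSpace ℝ (Fin 2)) (r : V → ℝ) : Prop where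
  r_pos : ∀ v, 0 < r v
  disj : ∀ u v, u ≠ v → Disjoint (ball (c u) (r u)) (ball (c v) (r v))
  touch : ∀ u v, G.Adj u v →
    (closedBall (c u) (r u) ∩ closedBall (c v) (r v)).Nonempty

/-- The set of vertices weakly `d`-reachable from `u`: vertices `w ⪯ u` joined to `u`
by a path of length at most `d` all of whose vertices are `⪰ w`. -/
def WReach {V : Type*} [LinearOrder V] (G : SimpleGraph V) (d : ℕ) (u : V) : Set V :=
  {w | w ≤ u ∧ ∃ p : G.Walk u w, p.IsPath ∧ p.length ≤ d ∧ ∀ x ∈ p.support, w ≤ x}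

lemma kw_three (a b z : EuclideanSpace ℝ (Fin 2)) (d s ρ : ℝ) (hd : 1 ≤ d) (hs : 0 < s)
    (hρ : ρ = 50 * d ^ 2 * s) (ha : ‖a‖ ≤ ρ + s / 2) (hb : ‖b‖ ≤ ρ + s / 2)
    (hab : 2 * ρ ≤ ‖a - b‖) (hza : ρ + s ≤ ‖z - a‖) (hzb : ρ + s ≤ ‖z - b‖)
    (hz : ‖z‖ ≤ 2 * d * s) : False := by
  have hρ0 : 0 < ρ := by rw [hρ]; positivity
  have h1 := norm_sub_sq_real a b
  have h2 := norm_add_sq_real a b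
  have h3 := norm_sub_sq_real z a
  have h4 := norm_sub_sq_real z b
  have h5 : inner ℝ z (a + b) = inner ℝ z a + inner ℝ z b := inner_add_right z a b
  have h6 := abs_real_inner_le_norm z (a + b)
  have h7 := (abs_le.1 h6).1
  have ea : ‖a‖ ^ 2 ≤ (ρ + s / 2) ^ 2 := by gcongr
  have eb : ‖b‖ ^ 2 ≤ (ρ + s / 2) ^ 2 := by gcongr
  have eab : (2 * ρ) ^ 2 ≤ ‖a - b‖ ^ 2 := by gcongr
  have eza : (ρ + s) ^ 2 ≤ ‖z - a‖ ^ 2 := by gcongr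
  have ezb : (ρ + s) ^ 2 ≤ ‖z - b‖ ^ 2 := by gcongr
  have ez : ‖z‖ ^ 2 ≤ (2 * d * s) ^ 2 := by gcongr
  have hss : s ^ 2 ≤ d ^ 2 * s ^ 2 := by
    have : 1 ≤ d ^ 2 := by nlinarith
    nlinarith [sq_nonneg s]
  have hρs : ρ * s = 50 * (d ^ 2 * s ^ 2) := by rw [hρ]; ring
  have hn : ‖a + b‖ ≤ 15 * d * s := by
    refine (abs_le_of_sq_le_sq' ?_ (by positivity)).2
    nlinarith
  have hm : ‖z‖ * ‖a + b‖ ≤ (2 * d * s) * (15 * d * s) := by gcongr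
  have hpos : 0 < d ^ 2 * s ^ 2 := by positivity
  nlinarith

lemma kw_shrink (a : EuclideanSpace ℝ (Fin 2)) (R ρ e : ℝ) (hρ : 0 < ρ) (hR : ρ ≤ R)
    (h1 : R ≤ ‖a‖) (h2 : ‖a‖ ≤ R + e) :
    ∃ a' : EuclideanSpace ℝ (Fin 2), ‖a'‖ ≤ ρ + e ∧ ‖a - a'‖ ≤ R - ρ := by
  have hpos : 0 < ‖a‖ := by linarith
  have h0 : 0 ≤ (R - ρ) / ‖a‖ := div_nonneg (by linarith) hpos.le
  have h3 : (R - ρ) / ‖a‖ ≤ 1 := by rw [div_le_one hpos]; linarith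
  refine ⟨(1 - (R - ρ) / ‖a‖) • a, ?_, ?_⟩
  · rw [norm_smul, Real.norm_of_nonneg (by linarith), sub_mul, div_mul_cancel₀ _ (ne_of_gt hpos)]
    linarith
  · have : a - (1 - (R - ρ) / ‖a‖) • a = ((R - ρ) / ‖a‖) • a := by
      rw [sub_smul, one_smul]; abel
    rw [this, norm_smul, Real.norm_of_nonneg h0, div_mul_cancel₀ _ (ne_of_gt hpos)]

/-- Two huge disks near `p` leave no room for a third disk. -/
lemma kw_cross (p x y w : EuclideanSpace ℝ (Fin 2)) (R₁ R₂ d s : ℝ) (hd : 1 ≤ d) (hs : 0 < s)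
    (hx : 50 * d ^ 2 * s ≤ R₁) (hy : 50 * d ^ 2 * s ≤ R₂)
    (px : R₁ ≤ dist x p) (py : R₂ ≤ dist y p)
    (px' : dist x p ≤ R₁ + s / 2) (py' : dist y p ≤ R₂ + s / 2)
    (hxy : R₁ + R₂ ≤ dist x y) (hxw : R₁ + s ≤ dist x w) (hyw : R₂ + s ≤ dist y w)
    (hw : dist w p ≤ 2 * d * s) : False := by
  have hρ0 : 0 < 50 * d ^ 2 * s := by positivity
  rw [dist_eq_norm] at *
  obtain ⟨a, ha, ha'⟩ := kw_shrink (x - p) R₁ _ (s / 2) hρ0 hx px px'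
  obtain ⟨b, hb, hb'⟩ := kw_shrink (y - p) R₂ _ (s / 2) hρ0 hy py py'
  refine kw_three a b (w - p) d s _ hd hs rfl ha hb ?_ ?_ ?_ hw
  · have : x - y = (x - p - a) + (a - b) - (y - p - b) := by abel
    have h1 := norm_sub_le ((x - p - a) + (a - b)) (y - p - b)
    have h2 := norm_add_le (x - p - a) (a - b)
    rw [← this] at h1
    linarith
  · have : x - w = (x - p - a) - (w - p - a) := by abel
    have h1 := norm_sub_le (x - p - a) (w - p - a)
    rw [← this] at h1
    linarith
  · have : y - w = (y - p - b) - (w - p - b) := by abel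
    have h1 := norm_sub_le (y - p - b) (w - p - b)
    rw [← this] at h1
    linarith

lemma kw_sep {V : Type} {G : SimpleGraph V} {c : V → EuclideanSpace ℝ (Fin 2)} {r : V → ℝ}
    (h : IsCoinModel G c r) {u v : V} (huv : u ≠ v) : r u + r v ≤ dist (c u) (c v) :=
  (disjoint_ball_ball_iff (h.r_pos u) (h.r_pos v)).1 (h.disj u v huv)

lemma kw_adj {V : Type} {G : SimpleGraph V} {c : V → EuclideanSpace ℝ (Fin 2)} {r : V → ℝ}
    (h : IsCoinModel G c r) {u v : V} (huv : G.Adj u v) : dist (c u) (c v) ≤ r u + r v := by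
  obtain ⟨x, hx, hy⟩ := h.touch u v huv
  rw [mem_closedBall] at hx hy
  have := dist_triangle_left (c u) (c v) x
  linarith

lemma kw_walk {V : Type} {G : SimpleGraph V} {c : V → EuclideanSpace ℝ (Fin 2)} {r : V → ℝ}
    (h : IsCoinModel G c r) (s : ℝ) {u v : V} (p : G.Walk u v) :
    (∀ x ∈ p.support, r x ≤ s) → dist (c u) (c v) ≤ 2 * p.length * s := by
  induction p with
  | nil => intro _; simp
  | @cons a b e hab q ih =>
    intro hs
    have h1 := ih (fun x hx => hs x (by simp [hx]))
    have h2 := kw_adj h hab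
    have h3 := dist_triangle (c a) (c b) (c e)
    have h4 := hs a (by simp)
    have h5 := hs b (by simp)
    rw [SimpleGraph.Walk.length_cons]
    push_cast
    linarith

/-- Area packing bound. -/
lemma kw_pack {V : Type} (c : V → EuclideanSpace ℝ (Fin 2)) (T : Finset V)
    (p : EuclideanSpace ℝ (Fin 2)) (R d : ℝ) (hR : 0 < R) (hd : 0 ≤ d)
    (hsep : ∀ x ∈ T, ∀ y ∈ T, x ≠ y → R + R ≤ dist (c x) (c y))
    (hin : ∀ x ∈ T, dist (c x) p ≤ 4 * d * R) : (T.card : ℝ) ≤ (4 * d + 1) ^ 2 := by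
  let μ : MeasureTheory.Measure (EuclideanSpace ℝ (Fin 2)) := MeasureTheory.volume
  have hdisj : (T : Set V).PairwiseDisjoint (fun x => ball (c x) R) := by
    intro x hx y hy hxy
    exact (disjoint_ball_ball_iff hR hR).2 (hsep x hx y hy hxy)
  have h1 : μ (⋃ x ∈ T, ball (c x) R) = ∑ x ∈ T, μ (ball (c x) R) :=
    MeasureTheory.measure_biUnion_finset hdisj (fun x _ => measurableSet_ball)
  have h2 : μ (⋃ x ∈ T, ball (c x) R) ≤ μ (ball p ((4 * d + 1) * R)) := by
    apply MeasureTheory.measure_mono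
    intro z hz
    simp only [Set.mem_iUnion] at hz
    obtain ⟨x, hx, hz⟩ := hz
    rw [mem_ball] at hz ⊢
    have := dist_triangle z (c x) p
    have := hin x hx
    linarith
  rw [h1] at h2
  have e1 : ∀ x : EuclideanSpace ℝ (Fin 2), ∀ t : ℝ, 0 ≤ t →
      μ (ball x t) = ENNReal.ofReal (t ^ 2) * μ (ball 0 1) := by
    intro x t ht
    have := MeasureTheory.Measure.addHaar_ball μ x ht
    simpa using this
  rw [Finset.sum_congr rfl (fun x _ => e1 (c x) R hR.le), e1 p _ (by positivity)] at h2
  rw [Finset.sum_const, nsmul_eq_mul, ← mul_assoc] at h2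
  have hm0 : μ (ball 0 1) ≠ 0 := (measure_ball_pos μ _ one_pos).ne'
  have hmt : μ (ball 0 1) ≠ ⊤ := MeasureTheory.measure_ball_lt_top.ne
  rw [ENNReal.mul_le_mul_iff_left hm0 hmt] at h2
  rw [← ENNReal.ofReal_natCast, ← ENNReal.ofReal_mul (by positivity),
    ENNReal.ofReal_le_ofReal_iff (by positivity), mul_pow] at h2
  exact le_of_mul_le_mul_right h2 (by positivity)

/-- A family of weakly reachable vertices with widely separated radii is small. -/
lemma kw_chain {V : Type} [Fintype V] [LinearOrder V] {G : SimpleGraph V}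
    {c : V → EuclideanSpace ℝ (Fin 2)} {r : V → ℝ} (h : IsCoinModel G c r)
    (hK : ∀ a b : V, r b < r a → a ≤ b) (d : ℕ) (hd : 2 ≤ d) (u : V) (T : Finset V)
    (hT : ∀ w ∈ T, w ∈ WReach G d u)
    (hsep : ∀ w ∈ T, ∀ v ∈ T, w ≠ v →
      256 * (d : ℝ) ^ 2 * r w ≤ r v ∨ 256 * (d : ℝ) ^ 2 * r v ≤ r w) :
    T.card ≤ (d + 2) ^ 2 := by
  classical
  have hd1 : (1 : ℝ) ≤ d := by exact_mod_cast (by omega : 1 ≤ d)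
  have hle : ∀ w x : V, w ≤ x → r x ≤ r w := by
    intro w x hwx
    by_contra hc
    push Not at hc
    have := hK x w hc
    have : x = w := le_antisymm this hwx
    subst this
    exact lt_irrefl _ hc
  have hp : ∀ w : V, ∃ P : Finset V, w ∈ T → (P.card ≤ d + 1 ∧ (∀ x ∈ P, r x ≤ r w) ∧
      ∀ N : V → Prop, N u → ¬ N w → ∃ z ∈ P, ∃ x ∈ P, G.Adj z x ∧ N z ∧ ¬ N x) := by
    intro w
    by_cases hw : w ∈ T
    swap
    · exact ⟨∅, fun h => absurd h hw⟩
    obtain ⟨_, p, _, hlen, hsup⟩ := hT w hw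
    refine ⟨p.support.toFinset, fun _ => ⟨?_, ?_, ?_⟩⟩
    · calc _ ≤ p.support.length := List.toFinset_card_le _
        _ ≤ d + 1 := by rw [SimpleGraph.Walk.length_support]; omega
    · intro x hx
      exact hle _ _ (hsup x (by simpa using hx))
    · intro N hu hw
      obtain ⟨e, he, h1, h2⟩ := p.exists_boundary_dart {x | N x} hu hw
      exact ⟨e.fst, by simpa using p.dart_fst_mem_support_of_mem_darts he,
        e.snd, by simpa using p.dart_snd_mem_support_of_mem_darts he, e.adj, h1, h2⟩
  choose P hP using hp
  have hdist : ∀ w ∈ T, dist (c w) (c u) ≤ 2 * d * r w := by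
    intro w hw
    obtain ⟨_, p, _, hlen, hsup⟩ := hT w hw
    have h1 := kw_walk h (r w) p (fun x hx => hle _ _ (hsup x hx))
    rw [dist_comm]
    have : (p.length : ℝ) ≤ d := by exact_mod_cast hlen
    have h0 := h.r_pos w
    calc _ ≤ _ := h1
      _ ≤ _ := by gcongr
  have hur : ∀ w ∈ T, r u ≤ r w := fun w hw => hle _ _ (hT w hw).1
  -- crossing
  let near : V → V → Prop := fun X i => dist (c X) (c u) ≤ r X + r i / 2
  let cross : V → V → Prop := fun X i => near X i ∧ 50 * (d : ℝ) ^ 2 * r i ≤ r X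
  have hbig : ∀ t : ℝ, 0 < t → t < 50 * (d : ℝ) ^ 2 * t := by
    intro t ht
    nlinarith [mul_pos ht ht, mul_le_mul hd1 hd1 (by norm_num) (by linarith)]
  have huniq : ∀ i ∈ T, ∀ X Y, cross X i → cross Y i → X = Y := by
    intro i hi X Y hX hY
    by_contra hne
    have hi0 := h.r_pos i
    have hb := hbig _ hi0
    have hui := hur i hi
    have hXu : X ≠ u := by rintro rfl; linarith [hX.2]
    have hYu : Y ≠ u := by rintro rfl; linarith [hY.2]
    have hXi : X ≠ i := by rintro rfl; linarith [hX.2]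
    have hYi : Y ≠ i := by rintro rfl; linarith [hY.2]
    have hu0 := h.r_pos u
    exact kw_cross (c u) (c X) (c Y) (c i) (r X) (r Y) d (r i) hd1 hi0 hX.2 hY.2
      (by linarith [kw_sep h hXu]) (by linarith [kw_sep h hYu]) hX.1 hY.1
      (kw_sep h hne) (kw_sep h hXi) (kw_sep h hYi) (hdist i hi)
  have hunc : ∀ j ∈ T, (T.filter (fun i => r i < r j ∧ ∀ X ∈ P j, ¬ cross X i)).card ≤ d + 1 := by
    intro j hj
    obtain ⟨hc, hr, hb⟩ := hP j hj
    refine le_trans ?_ hc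
    have hex : ∀ i, ∃ X, i ∈ T.filter (fun i => r i < r j ∧ ∀ X ∈ P j, ¬ cross X i) →
        X ∈ P j ∧ r i / 2 < dist (c X) (c u) - r X ∧
          dist (c X) (c u) - r X < 101 * (d : ℝ) ^ 2 * r i := by
      intro i
      by_cases hi : i ∈ T.filter (fun i => r i < r j ∧ ∀ X ∈ P j, ¬ cross X i)
      swap
      · exact ⟨i, fun h => absurd h hi⟩
      obtain ⟨hiT, hij, hnc⟩ := by simpa only [Finset.mem_filter] using hi
      have hi0 := h.r_pos i
      have hu0 := h.r_pos u
      have hjn : ¬ near j i := by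
        intro hn
        have hne : i ≠ j := by rintro rfl; exact lt_irrefl _ hij
        have hb2 := hbig _ hi0
        have hb3 := hbig _ (h.r_pos j)
        have hji : 256 * (d : ℝ) ^ 2 * r i ≤ r j := by
          rcases hsep i hiT j hj hne with h1 | h1
          · exact h1
          · nlinarith [h.r_pos j, hb3]
        have hjc : cross j i := ⟨hn, by nlinarith⟩
        by_cases hju : j = u
        · subst hju
          linarith [hur i hiT]
        · obtain ⟨z, hz, x, hx, -, h1, h2⟩ := hb (fun x => x ≠ j) (fun h => hju h.symm) (by simp)
          have : x = j := by simpa using h2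
          exact hnc x hx (this ▸ hjc)
      have hun : near u i := by
        change dist (c u) (c u) ≤ _
        rw [dist_self]; linarith
      obtain ⟨z, hz, x, hx, hadj, h1, h2⟩ := hb (fun x => near x i) hun hjn
      refine ⟨x, fun _ => ⟨hx, ?_, ?_⟩⟩
      · have : r x + r i / 2 < dist (c x) (c u) := not_le.1 h2
        linarith
      · have hzn : ¬ (50 * (d : ℝ) ^ 2 * r i ≤ r z) := fun h => hnc z hz ⟨h1, h⟩
        have h1' : dist (c z) (c u) ≤ r z + r i / 2 := h1
        have h3 := kw_adj h hadj
        have h4 := dist_triangle_left (c x) (c u) (c z)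
        have hb2 := hbig _ hi0
        have : r i ≤ (d : ℝ) ^ 2 * r i := by nlinarith [mul_le_mul hd1 hd1 (by norm_num) (by linarith)]
        linarith
    choose f hf using hex
    apply Finset.card_le_card_of_injOn f
    · intro i hi
      exact (hf i hi).1
    · intro i hi i' hi' hff
      by_contra hne
      have a := hf i hi
      have b := hf i' hi'
      rw [hff] at a
      have hiT := (Finset.mem_filter.1 hi).1
      have hiT' := (Finset.mem_filter.1 hi').1
      have p1 : 0 < (d : ℝ) ^ 2 * r i := mul_pos (by positivity) (h.r_pos i)
      have p2 : 0 < (d : ℝ) ^ 2 * r i' := mul_pos (by positivity) (h.r_pos i')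
      rcases hsep i hiT i' hiT' hne with h1 | h1 <;> linarith
  have hcr : ∀ Y, (T.filter (fun i => cross Y i)).card ≤ d + 2 := by
    intro Y
    rcases (T.filter (fun i => cross Y i)).eq_empty_or_nonempty with he | hne
    · rw [he]; simp
    obtain ⟨j, hj, hmax⟩ := Finset.exists_max_image _ r hne
    obtain ⟨hjT, hjc⟩ := Finset.mem_filter.1 hj
    have hsub : T.filter (fun i => cross Y i) ⊆
        insert j (T.filter (fun i => r i < r j ∧ ∀ X ∈ P j, ¬ cross X i)) := by
      intro i hi
      obtain ⟨hiT, hic⟩ := Finset.mem_filter.1 hi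
      by_cases hij : i = j
      · simp [hij]
      refine Finset.mem_insert_of_mem (Finset.mem_filter.2 ⟨hiT, ?_, ?_⟩)
      · refine lt_of_le_of_ne (hmax i hi) ?_
        intro he
        have hb := hbig _ (h.r_pos j)
        have := h.r_pos j
        rcases hsep i hiT j hjT hij with h1 | h1 <;> rw [he] at h1 <;> nlinarith
      · intro X hX hXc
        have : X = Y := huniq i hiT X Y hXc hic
        subst this
        have h1 := (hP j hjT).2.1 X hX
        have hb := hbig _ (h.r_pos j)
        linarith [hjc.2]
    calc _ ≤ _ := Finset.card_le_card hsub
      _ ≤ _ := Finset.card_insert_le _ _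
      _ ≤ _ := by have := hunc j hjT; omega
  rcases T.eq_empty_or_nonempty with he | hne
  · rw [he]; simp
  obtain ⟨m, hm, hmax⟩ := Finset.exists_max_image T r hne
  have hsub : T ⊆ insert m ((T.filter (fun i => r i < r m ∧ ∀ X ∈ P m, ¬ cross X i)) ∪
      (P m).biUnion (fun Y => T.filter (fun i => cross Y i))) := by
    intro i hi
    by_cases him : i = m
    · simp [him]
    refine Finset.mem_insert_of_mem (Finset.mem_union.2 ?_)
    by_cases hc : ∀ X ∈ P m, ¬ cross X i
    · left
      refine Finset.mem_filter.2 ⟨hi, lt_of_le_of_ne (hmax i hi) ?_, hc⟩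
      intro he
      have hb := hbig _ (h.r_pos m)
      have := h.r_pos m
      rcases hsep i hi m hm him with h1 | h1 <;> rw [he] at h1 <;> nlinarith
    · right
      push Not at hc
      obtain ⟨X, hX, hXc⟩ := hc
      exact Finset.mem_biUnion.2 ⟨X, hX, Finset.mem_filter.2 ⟨hi, hXc⟩⟩
  have h1 := Finset.card_le_card hsub
  have h2 := Finset.card_insert_le m ((T.filter (fun i => r i < r m ∧ ∀ X ∈ P m, ¬ cross X i)) ∪
      (P m).biUnion (fun Y => T.filter (fun i => cross Y i)))
  have h3 := Finset.card_union_le (T.filter (fun i => r i < r m ∧ ∀ X ∈ P m, ¬ cross X i))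
      ((P m).biUnion (fun Y => T.filter (fun i => cross Y i)))
  have h4 := Finset.card_biUnion_le_card_mul (P m) (fun Y => T.filter (fun i => cross Y i)) (d + 2)
    (fun Y _ => hcr Y)
  have h5 := hunc m hm
  have h6 : (P m).card * (d + 2) ≤ (d + 1) * (d + 2) := Nat.mul_le_mul_right _ (hP m hm).1
  nlinarith

/-- For any Koebe ordering of a graph with a coin model,
`|WReach_d[u]| ≤ C·d⁴·ln d` for every vertex `u`. -/
theorem koebe_wreach_upper_bound :
    ∃ C : ℝ, 0 < C ∧
      ∀ (d : ℕ), 2 ≤ d →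
      ∀ (V : Type) [Fintype V] [LinearOrder V],
      ∀ (G : SimpleGraph V) (c : V → EuclideanSpace ℝ (Fin 2)) (r : V → ℝ),
        IsCoinModel G c r →
        (∀ a b : V, r b < r a → a ≤ b) →
        ∀ u : V, ((WReach G d u).ncard : ℝ) ≤ C * d ^ 4 * Real.log d := by
  refine ⟨2600, by norm_num, ?_⟩
  intro d hd V _ _ G c r h hK u
  classical
  have hd2 : (2 : ℝ) ≤ d := by exact_mod_cast hd
  set W : Finset V := (WReach G d u).toFinset with hW
  have hWm : ∀ w, w ∈ W ↔ w ∈ WReach G d u := by intro w; simp [hW]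
  have hcard : (WReach G d u).ncard = W.card := Set.ncard_eq_toFinset_card' _
  rw [hcard]
  have hle : ∀ w x : V, w ≤ x → r x ≤ r w := by
    intro w x hwx
    by_contra hc
    push Not at hc
    have := hK x w hc
    have : x = w := le_antisymm this hwx
    subst this
    exact lt_irrefl _ hc
  have hu0 := h.r_pos u
  have hlev : ∀ w, ∃ k : ℕ, w ∈ W → r u * 2 ^ k ≤ r w ∧ r w < r u * 2 ^ (k + 1) := by
    intro w
    by_cases hw : w ∈ W
    swap
    · exact ⟨0, fun h => absurd h hw⟩
    have h1 : 1 ≤ r w / r u := by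
      rw [one_le_div hu0]; exact hle _ _ ((hWm w).1 hw).1
    obtain ⟨k, hk1, hk2⟩ := exists_nat_pow_near h1 (one_lt_two)
    refine ⟨k, fun _ => ⟨?_, ?_⟩⟩
    · rw [le_div_iff₀ hu0] at hk1; linarith
    · rw [div_lt_iff₀ hu0] at hk2; linarith
  choose k hk using hlev
  -- each dyadic level
  have hfib : ∀ n ∈ W.image k, ((W.filter (fun w => k w = n)).card) ≤ (4 * d + 1) ^ 2 := by
    intro n _
    have hR : 0 < r u * 2 ^ n := by positivity
    have := kw_pack c (W.filter (fun w => k w = n)) (c u) (r u * 2 ^ n) d hR (by positivity) ?_ ?_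
    · exact_mod_cast this
    · intro x hx y hy hxy
      obtain ⟨hxW, rfl⟩ := Finset.mem_filter.1 hx
      replace hx := hxW
      obtain ⟨hy, hkk⟩ := Finset.mem_filter.1 hy
      have h1 := (hk x hx).1
      have h2 := (hk y hy).1
      rw [hkk] at h2
      linarith [kw_sep h hxy]
    · intro x hx
      obtain ⟨hxW, rfl⟩ := Finset.mem_filter.1 hx
      replace hx := hxW
      obtain ⟨_, p, _, hlen, hsup⟩ := (hWm x).1 hx
      have h1 := kw_walk h (r x) p (fun y hy => hle _ _ (hsup y hy))
      rw [dist_comm]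
      have h3 : (p.length : ℝ) ≤ d := by exact_mod_cast hlen
      have h0 := h.r_pos x
      have h2 := (hk x hx).2
      rw [pow_succ] at h2
      calc _ ≤ _ := h1
        _ ≤ 2 * d * (2 * (r u * 2 ^ k x)) := by gcongr; linarith
        _ = _ := by ring
  set q : ℕ := 2 * Nat.log 2 d + 10 with hq
  have hqD : 256 * (d : ℝ) ^ 2 ≤ 2 ^ q := by
    have h1 : d < 2 ^ (Nat.log 2 d + 1) := Nat.lt_pow_succ_log_self (by norm_num) d
    have h2 : (d : ℝ) ≤ 2 ^ (Nat.log 2 d + 1) := by exact_mod_cast h1.le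
    have h3 : (2 : ℝ) ^ q = 256 * (2 ^ (Nat.log 2 d + 1)) ^ 2 := by
      rw [hq, ← pow_mul]
      rw [show 2 * Nat.log 2 d + 10 = 8 + (Nat.log 2 d + 1) * 2 by ring, pow_add]
      norm_num
    rw [h3]; gcongr
  have hres : ∀ a ∈ Finset.range (q + 1),
      ((W.image k).filter (fun n => n % (q + 1) = a)).card ≤ (d + 2) ^ 2 := by
    intro a _
    have hrep : ∀ n, ∃ w, n ∈ W.image k → w ∈ W ∧ k w = n := by
      intro n
      by_cases hn : n ∈ W.image k
      · obtain ⟨w, hw, he⟩ := Finset.mem_image.1 hn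
        exact ⟨w, fun _ => ⟨hw, he⟩⟩
      · exact ⟨u, fun h => absurd h hn⟩
    choose g hg using hrep
    set S := (W.image k).filter (fun n => n % (q + 1) = a) with hS
    have hSm : ∀ n ∈ S, n ∈ W.image k ∧ n % (q + 1) = a := fun n hn => Finset.mem_filter.1 hn
    have hinj : Set.InjOn g S := by
      intro n hn m hm he
      rw [← (hg n (hSm n hn).1).2, ← (hg m (hSm m hm).1).2, he]
    rw [← Finset.card_image_of_injOn hinj]
    have key : ∀ n ∈ S, ∀ m ∈ S, n < m → 256 * (d : ℝ) ^ 2 * r (g n) ≤ r (g m) := by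
      intro n hn m hm hnm
      have a1 := hSm n hn
      have a2 := hSm m hm
      have b1 := hg n a1.1
      have b2 := hg m a2.1
      have c1 := (hk _ b1.1).2
      have c2 := (hk _ b2.1).1
      rw [b1.2] at c1
      rw [b2.2] at c2
      have hqm : n + 1 + q ≤ m := by
        have hdv : (q + 1) ∣ m - n := (Nat.modEq_iff_dvd' hnm.le).1 (a1.2.trans a2.2.symm)
        have := Nat.le_of_dvd (by omega) hdv
        omega
      calc 256 * (d : ℝ) ^ 2 * r (g n) ≤ 2 ^ q * (r u * 2 ^ (n + 1)) := by
            have := h.r_pos (g n)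
            gcongr
        _ = r u * 2 ^ (n + 1 + q) := by rw [pow_add 2 (n + 1) q]; ring
        _ ≤ r u * 2 ^ m := by gcongr; norm_num
        _ ≤ _ := c2
    apply kw_chain h hK d hd u
    · intro w hw
      obtain ⟨n, hn, rfl⟩ := Finset.mem_image.1 hw
      exact (hWm _).1 (hg n (hSm n hn).1).1
    · intro w hw v hv hwv
      obtain ⟨n, hn, rfl⟩ := Finset.mem_image.1 hw
      obtain ⟨m, hm, rfl⟩ := Finset.mem_image.1 hv
      have hnm : n ≠ m := by rintro rfl; exact hwv rfl
      rcases lt_or_gt_of_ne hnm with h1 | h1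
      · left; exact key n hn m hm h1
      · right; exact key m hm n hn h1
  have t1 : W.card ≤ (4 * d + 1) ^ 2 * (W.image k).card :=
    Finset.card_le_mul_card_image W _ hfib
  have t2 : (W.image k).card ≤ (d + 2) ^ 2 * (Finset.range (q + 1)).card :=
    Finset.card_le_mul_card_image_of_maps_to
      (f := fun n => n % (q + 1)) (fun n _ => Finset.mem_range.2 (Nat.mod_lt n (Nat.succ_pos q))) _ hres
  rw [Finset.card_range] at t2
  have t3 : W.card ≤ (4 * d + 1) ^ 2 * ((d + 2) ^ 2 * (q + 1)) :=
    t1.trans (Nat.mul_le_mul_left _ t2)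
  have t4 : (W.card : ℝ) ≤ (4 * d + 1) ^ 2 * ((d + 2) ^ 2 * (q + 1)) := by exact_mod_cast t3
  have hlog : (q : ℝ) + 1 ≤ 26 * Real.log d := by
    have hL : 1 ≤ Nat.log 2 d := Nat.log_pos (by norm_num) hd
    have hL' : (1 : ℝ) ≤ Nat.log 2 d := by exact_mod_cast hL
    have h1 : 2 ^ Nat.log 2 d ≤ d := Nat.pow_log_le_self 2 (by omega)
    have h2 : (2 : ℝ) ^ Nat.log 2 d ≤ d := by exact_mod_cast h1
    have h3 := Real.log_le_log (by positivity) h2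
    rw [Real.log_pow] at h3
    have h4 := Real.log_two_gt_d9
    have h5 : (Nat.log 2 d : ℝ) * (1 / 2) ≤ Nat.log 2 d * Real.log 2 := by
      gcongr; linarith
    rw [hq]; push_cast
    linarith
  have hlog0 : 0 ≤ Real.log d := Real.log_nonneg (by linarith)
  calc (W.card : ℝ) ≤ _ := t4
    _ ≤ (5 * d) ^ 2 * ((2 * d) ^ 2 * (26 * Real.log d)) := by
        gcongr <;> linarith
    _ = _ := by ring
end

section
/- Let d > 12 be an integer, let G be a finite simple graph with coin model (c, r), let ⪯ be a Koebe ordering of G with respect to (c, r), and let u be a vertex with c(u) = 0 and r(u) = 1. Then the number of integers i ≥ 0 such that B_i ∩ WReach_d[u] ≠ ∅ is at most (d+1)². -/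
open Metric

/-- The bucket `B_i`: vertices `v` with `d^{3i} ≤ r v < d^{3i+3}`. -/
def bucket {V : Type*} (r : V → ℝ) (d : ℕ) (i : ℤ) : Set V :=
  {v | (d : ℝ) ^ (3 * i) ≤ r v ∧ r v < (d : ℝ) ^ (3 * i + 3)}


lemma coin_dist_le {V : Type} {G : SimpleGraph V} {c : V → EuclideanSpace ℝ (Fin 2)} {r : V → ℝ}
    (h : IsCoinModel G c r) {a b : V} (hab : G.Adj a b) : dist (c a) (c b) ≤ r a + r b := by
  obtain ⟨z, hz1, hz2⟩ := h.touch a b hab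
  rw [mem_closedBall] at hz1 hz2
  have := dist_triangle_left (c a) (c b) z
  linarith

lemma coin_near {V : Type} {G : SimpleGraph V} {c : V → EuclideanSpace ℝ (Fin 2)} {r : V → ℝ}
    (h : IsCoinModel G c r) {a b : V} (hab : G.Adj a b) :
    ‖c b‖ - r b ≤ ‖c a‖ + r a := by
  have h1 := coin_dist_le h hab
  have h2 := norm_sub_norm_le (c b) (c a)
  rw [dist_comm, dist_eq_norm] at h1
  linarith

/-- Far ends along a walk whose first `n` disks have radius at most `ρ`. -/
lemma walk_near {V : Type} {G : SimpleGraph V} {c : V → EuclideanSpace ℝ (Fin 2)} {r : V → ℝ}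
    (h : IsCoinModel G c r) {u w : V} (hcu : c u = 0) (p : G.Walk u w) (ρ : ℝ) (hρ : 0 ≤ ρ) (n : ℕ)
    (hn : n ≤ p.length) (hr : ∀ m < n, r (p.getVert m) ≤ ρ) :
    ‖c (p.getVert n)‖ - r (p.getVert n) ≤ 2 * n * ρ := by
  induction n with
  | zero =>
    have := h.r_pos u
    simp [hcu]; linarith
  | succ n ih =>
    have h1 := ih (by omega) (fun m hm => hr m (by omega))
    have h2 := coin_near h (p.adj_getVert_succ (show n < p.length by omega))
    have h3 := hr n (by omega)
    push_cast
    nlinarith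

/-- Replace a disk by a standard subdisk. -/
lemma subdisk (x : EuclideanSpace ℝ (Fin 2)) (R A B : ℝ) (hx : x ≠ 0) (hA : 0 < A) (hAB : A < B)
    (h1 : ‖x‖ - R ≤ A) (h2 : B ≤ ‖x‖ + R) :
    ∃ p : EuclideanSpace ℝ (Fin 2), ‖p‖ = (A + B) / 2 ∧ ball p ((B - A) / 2) ⊆ ball x R := by
  have hx' : 0 < ‖x‖ := norm_pos_iff.mpr hx
  refine ⟨((A + B) / 2 / ‖x‖) • x, ?_, ?_⟩
  · rw [norm_smul, Real.norm_eq_abs, abs_of_pos (div_pos (by linarith) hx')]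
    field_simp
  · apply ball_subset_ball'
    have : dist (((A + B) / 2 / ‖x‖) • x) x = |(A + B) / 2 - ‖x‖| := by
      rw [dist_eq_norm]
      have e : ((A + B) / 2 / ‖x‖) • x - x = ((A + B) / 2 / ‖x‖ - 1) • x := by
        rw [sub_smul, one_smul]
      rw [e, norm_smul, Real.norm_eq_abs]
      nth_rewrite 2 [← abs_of_pos hx']
      rw [← abs_mul]
      congr 1
      field_simp
    rw [this]
    have : |(A + B) / 2 - ‖x‖| ≤ R - (B - A) / 2 := by
      rw [abs_le]; constructor <;> linarith
    linarith

lemma geom_core (p p' z : EuclideanSpace ℝ (Fin 2)) (A B ρ q : ℝ) (hA : 0 < A) (hAB : A < B)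
    (hρ : 0 < ρ) (hq : 0 ≤ q) (hqq : q ^ 2 = A * B)
    (hp : ‖p‖ = (A + B) / 2) (hp' : ‖p'‖ = (A + B) / 2)
    (h1 : B - A ≤ ‖p - p'‖) (h2 : (B - A) / 2 + ρ ≤ ‖z - p‖) (h3 : (B - A) / 2 + ρ ≤ ‖z - p'‖) :
    (B - A) * ρ + ρ ^ 2 ≤ (‖z‖ + q) ^ 2 := by
  have par := parallelogram_law_with_norm ℝ p p'
  have e1 : (B - A) ^ 2 ≤ ‖p - p'‖ ^ 2 := by
    apply pow_le_pow_left₀ (by linarith) h1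
  have e2 : ((B - A) / 2 + ρ) ^ 2 ≤ ‖z - p‖ ^ 2 := by
    apply pow_le_pow_left₀ (by linarith) h2
  have e3 : ((B - A) / 2 + ρ) ^ 2 ≤ ‖z - p'‖ ^ 2 := by
    apply pow_le_pow_left₀ (by linarith) h3
  have f2 := norm_sub_sq_real z p
  have f3 := norm_sub_sq_real z p'
  have g : ‖p + p'‖ ≤ 2 * q := by
    apply le_of_sq_le_sq _ (by linarith)
    rw [hp, hp'] at par
    nlinarith
  have k := abs_real_inner_le_norm z (p + p')
  rw [inner_add_right] at k
  have k2 := (abs_le.mp k).1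
  have k3 : ‖z‖ * ‖p + p'‖ ≤ ‖z‖ * (2 * q) := by gcongr
  rw [hp] at f2
  rw [hp'] at f3
  nlinarith

lemma disj_dist {p p' : EuclideanSpace ℝ (Fin 2)} {a b : ℝ} (ha : 0 < a) (hb : 0 < b)
    (h : Disjoint (ball p a) (ball p' b)) : a + b ≤ ‖p - p'‖ := by
  rw [← dist_eq_norm]
  exact (disjoint_ball_ball_iff ha hb).1 h

lemma geom {V : Type} {G : SimpleGraph V} {c : V → EuclideanSpace ℝ (Fin 2)} {r : V → ℝ}
    (h : IsCoinModel G c r) (v v' x : V) (hv : v ≠ v') (hx : x ≠ v) (hx' : x ≠ v')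
    (A B q : ℝ) (hA : 0 < A) (hAB : A < B) (hq : 0 ≤ q) (hqq : q ^ 2 = A * B)
    (h0 : c v ≠ 0) (h0' : c v' ≠ 0)
    (h1 : ‖c v‖ - r v ≤ A) (h1' : ‖c v'‖ - r v' ≤ A)
    (h2 : B ≤ ‖c v‖ + r v) (h2' : B ≤ ‖c v'‖ + r v') :
    (B - A) * r x + r x ^ 2 ≤ (‖c x‖ + q) ^ 2 := by
  obtain ⟨p, hp, hs⟩ := subdisk (c v) (r v) A B h0 hA hAB h1 h2
  obtain ⟨p', hp', hs'⟩ := subdisk (c v') (r v') A B h0' hA hAB h1' h2'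
  have hr := h.r_pos x
  have hB : 0 < (B - A) / 2 := by linarith
  have d1 := disj_dist hB hB ((h.disj v v' hv).mono hs hs')
  have d2 := disj_dist hr hB ((h.disj x v hx).mono_right hs)
  have d3 := disj_dist hr hB ((h.disj x v' hx').mono_right hs')
  exact geom_core p p' (c x) A B (r x) q hA hAB hr hq hqq hp hp' (by linarith) (by linarith)
    (by linarith)

lemma numeric (d A B q ρ s : ℝ) (hd : 13 ≤ d) (hA : 0 < A) (hB : d ^ 5 * A ≤ B) (hq : 0 ≤ q)
    (hqq : q ^ 2 = A * B) (hs : 0 ≤ s) (hρ : 0 < ρ) (ht : s - ρ ≤ 5 * d * A)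
    (hg : (B - A) * ρ + ρ ^ 2 ≤ (s + q) ^ 2) : ρ ≤ 2 * A := by
  by_contra! hcon
  have d3 : (2197 : ℝ) ≤ d ^ 3 := by
    calc (2197 : ℝ) = 13 ^ 3 := by norm_num
      _ ≤ d ^ 3 := by gcongr
  have d5 : (371293 : ℝ) ≤ d ^ 5 := by
    calc (371293 : ℝ) = 13 ^ 5 := by norm_num
      _ ≤ d ^ 5 := by gcongr
  have hBA : 371293 * A ≤ B := le_trans (by gcongr) hB
  have hq1 : d ^ 5 * A ^ 2 ≤ q ^ 2 := by rw [hqq]; nlinarith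
  have hq600 : 600 * A ≤ q := by
    apply le_of_sq_le_sq _ hq
    nlinarith [sq_nonneg A]
  have h45 : 45 * d * A ≤ q := by
    apply le_of_sq_le_sq _ hq
    have : 2197 * (d ^ 2 * A ^ 2) ≤ d ^ 3 * (d ^ 2 * A ^ 2) := by gcongr
    nlinarith [sq_nonneg (d * A)]
  have hqpos : 0 < q := by linarith
  have hBpos : 0 < B := by linarith
  have hqB : 600 * q ≤ B := by
    have : q * (600 * q) ≤ q * B := by nlinarith
    exact le_of_mul_le_mul_left this hqpos
  have h5 : s + q ≤ 10 / 9 * q + ρ := by linarith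
  have h6 : (s + q) ^ 2 ≤ (10 / 9 * q + ρ) ^ 2 := by gcongr
  have h7 : (10 / 9 * q + ρ) ^ 2 = 100 / 81 * (A * B) + 20 / 9 * q * ρ + ρ ^ 2 := by
    rw [← hqq]; ring
  have h8 : A * B ≤ ρ / 2 * B := by gcongr; linarith
  have h9 : q * ρ ≤ B / 600 * ρ := by gcongr; linarith
  have h10 : A * ρ ≤ B / 371293 * ρ := by gcongr; linarith
  have h11 : 0 < B * ρ := by positivity
  nlinarith

/-- A walk avoiding two disks that nearly close off the plane cannot reach big disks. -/
lemma walk_small {V : Type} {G : SimpleGraph V} {c : V → EuclideanSpace ℝ (Fin 2)} {r : V → ℝ}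
    (h : IsCoinModel G c r) {u w : V} (hcu : c u = 0) (hru : r u = 1) (p : G.Walk u w)
    (d : ℕ) (hd : 12 < d) (hlen : p.length ≤ d)
    (v v' : V) (hv : v ≠ v') (A B : ℝ) (hA : 1 ≤ A) (hB : (d : ℝ) ^ 5 * A ≤ B)
    (h0 : c v ≠ 0) (h0' : c v' ≠ 0)
    (h1 : ‖c v‖ - r v ≤ A) (h1' : ‖c v'‖ - r v' ≤ A)
    (h2 : B ≤ ‖c v‖ + r v) (h2' : B ≤ ‖c v'‖ + r v')
    (hp : ∀ x ∈ p.support, x ≠ v ∧ x ≠ v') (n : ℕ) (hn : n ≤ p.length) :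
    r (p.getVert n) ≤ 2 * A ∧ ‖c (p.getVert n)‖ + r (p.getVert n) ≤ (4 * n + 1) * A := by
  have hd' : (13 : ℝ) ≤ d := by exact_mod_cast hd
  induction n with
  | zero => simp [hcu, hru]; constructor <;> linarith
  | succ n ih =>
    obtain ⟨-, ih2⟩ := ih (by omega)
    have h3 := coin_near h (p.adj_getVert_succ (show n < p.length by omega))
    obtain ⟨hx, hx'⟩ := hp _ (p.getVert_mem_support (n + 1))
    have hnd : (n : ℝ) + 1 ≤ d := by exact_mod_cast (show n + 1 ≤ d by omega)
    have d5 : (2 : ℝ) ≤ (d : ℝ) ^ 5 := by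
      calc (2 : ℝ) ≤ 13 ^ 5 := by norm_num
        _ ≤ (d : ℝ) ^ 5 := by gcongr
    have hAB : A < B := by nlinarith
    have hq : (0 : ℝ) ≤ Real.sqrt (A * B) := Real.sqrt_nonneg _
    have hqq : Real.sqrt (A * B) ^ 2 = A * B := Real.sq_sqrt (by nlinarith)
    have hg := geom h v v' _ hv hx hx' A B _ (by linarith) hAB hq hqq h0 h0' h1 h1' h2 h2'
    have hr := numeric d A B _ _ _ hd' (by linarith) hB hq hqq (norm_nonneg _) (h.r_pos _)
      (by nlinarith) hg
    refine ⟨hr, ?_⟩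
    push_cast
    nlinarith

/-- The contradiction from three buckets. -/
lemma three_buckets {V : Type} {G : SimpleGraph V} {c : V → EuclideanSpace ℝ (Fin 2)} {r : V → ℝ}
    (h : IsCoinModel G c r) {u w : V} (hcu : c u = 0) (hru : r u = 1) (p : G.Walk u w)
    (d : ℕ) (hd : 12 < d) (hlen : p.length ≤ d)
    (hp : ∀ x ∈ p.support, r x ≤ r w)
    (i i' i'' : ℤ) (hi : 0 ≤ i) (hii : i < i') (hii' : i' < i'')
    (hw : w ∈ bucket r d i')
    (v v' : V) (hv : v ≠ v')
    (h1 : ‖c v‖ - r v ≤ 2 * d * (d : ℝ) ^ (3 * i)) (h1' : ‖c v'‖ - r v' ≤ 2 * d * (d : ℝ) ^ (3 * i))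
    (h2 : (d : ℝ) ^ (3 * i'') ≤ r v) (h2' : (d : ℝ) ^ (3 * i'') ≤ r v') : False := by
  have hd' : (13 : ℝ) ≤ d := by exact_mod_cast hd
  have hd1 : (1 : ℝ) ≤ d := by linarith
  have hd0 : (d : ℝ) ≠ 0 := by positivity
  obtain ⟨hw1, hw2⟩ := hw
  have hX1 : (1 : ℝ) ≤ (d : ℝ) ^ (3 * i) := one_le_zpow₀ hd1 (by omega)
  have hX2 : (d : ℝ) ^ (3 * i) * (d : ℝ) ^ 3 ≤ (d : ℝ) ^ (3 * i') := by
    rw [← zpow_natCast, ← zpow_add₀ hd0]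
    exact zpow_le_zpow_right₀ hd1 (by push_cast; omega)
  have hX3 : (d : ℝ) ^ (3 * i) * (d : ℝ) ^ 6 ≤ (d : ℝ) ^ (3 * i'') := by
    rw [← zpow_natCast, ← zpow_add₀ hd0]
    exact zpow_le_zpow_right₀ hd1 (by push_cast; omega)
  have hX4 : r w < (d : ℝ) ^ (3 * i'') :=
    lt_of_lt_of_le hw2 (zpow_le_zpow_right₀ hd1 (by omega))
  set X := (d : ℝ) ^ (3 * i) with hX
  have hru1 : r u ≤ r w := hp u p.start_mem_support
  -- a disk larger than `u` is disjoint from `u`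
  have far : ∀ y : V, (d : ℝ) ^ (3 * i'') ≤ r y → r y + 1 ≤ ‖c y‖ := by
    intro y hy
    have hne : y ≠ u := by rintro rfl; linarith
    have := disj_dist (h.r_pos y) (h.r_pos u) (h.disj y u hne)
    rwa [hcu, sub_zero, hru] at this
  have f := far v h2
  have f' := far v' h2'
  have r1 := h.r_pos v
  have r2 := h.r_pos v'
  have key := walk_small h hcu hru p d hd hlen v v' hv (2 * d * X) (2 * (d : ℝ) ^ (3 * i''))
    (by nlinarith) (by nlinarith) (by rw [← norm_pos_iff]; linarith)
    (by rw [← norm_pos_iff]; linarith) h1 h1' (by linarith) (by linarith)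
    (fun x hx => by
      have := hp x hx
      constructor
      · rintro rfl; linarith
      · rintro rfl; linarith) p.length le_rfl
  have k := key.1
  rw [p.getVert_length] at k
  have : X * (d : ℝ) ^ 3 ≤ 4 * d * X := by linarith
  have d2 : (169 : ℝ) ≤ (d : ℝ) ^ 2 := by nlinarith
  have : 0 < d * X := by positivity
  nlinarith

/-- For a Koebe ordering whose first disk is the unit disk at the origin, at most
`(d+1)²` buckets `B_i` with `i ≥ 0` contain a vertex weakly `d`-reachable from `u`. -/
theorem koebe_few_buckets (d : ℕ) (hd : 12 < d) (V : Type) [Fintype V] [LinearOrder V]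
    (G : SimpleGraph V) (c : V → EuclideanSpace ℝ (Fin 2)) (r : V → ℝ)
    (hcm : IsCoinModel G c r) (hko : ∀ a b : V, r b < r a → a ≤ b)
    (u : V) (hcu : c u = 0) (hru : r u = 1) :
    {i : ℤ | 0 ≤ i ∧ (bucket r d i ∩ WReach G d u).Nonempty}.ncard ≤ (d + 1) ^ 2 := by
  classical
  set S := {i : ℤ | 0 ≤ i ∧ (bucket r d i ∩ WReach G d u).Nonempty} with hS
  by_cases hfin : S.Finite
  swap
  · rw [Set.Infinite.ncard hfin]; positivity
  have hd' : (13 : ℝ) ≤ d := by exact_mod_cast hd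
  have hd1 : (1 : ℝ) < d := by linarith
  -- choose a walk for every hit bucket
  have hit : ∀ i ∈ S, ∃ w, w ∈ bucket r d i ∧ ∃ p : G.Walk u w, p.length ≤ d ∧
      ∀ x ∈ p.support, r x ≤ r w := by
    rintro i ⟨hi, w, hwb, hwu, p, -, hpl, hps⟩
    refine ⟨w, hwb, p, hpl, fun x hx => ?_⟩
    by_contra! hlt
    have := le_antisymm (hko x w hlt) (hps x hx)
    rw [this] at hlt
    exact lt_irrefl _ hlt
  have hex : ∀ i : ℤ, i ∈ S → ∃ k, ∃ v, ∃ p : G.Walk u v, p.length = k ∧ (d : ℝ) ^ (3 * i) ≤ r v := by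
    intro i hi
    obtain ⟨w, hwb, p, hpl, -⟩ := hit i hi
    exact ⟨p.length, w, p, rfl, hwb.1⟩
  let L : ℤ → ℕ := fun i => sInf {k | ∃ v, ∃ p : G.Walk u v, p.length = k ∧ (d : ℝ) ^ (3 * i) ≤ r v}
  have Lspec : ∀ i ∈ S, ∃ v, ∃ p : G.Walk u v, p.length = L i ∧ (d : ℝ) ^ (3 * i) ≤ r v :=
    fun i hi => Nat.sInf_mem (hex i hi)
  have Lmin : ∀ i, ∀ v, ∀ p : G.Walk u v, (d : ℝ) ^ (3 * i) ≤ r v → L i ≤ p.length :=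
    fun i v p hv => Nat.sInf_le ⟨v, p, rfl, hv⟩
  have Lle : ∀ i ∈ S, L i ≤ d := by
    intro i hi
    obtain ⟨w, hwb, p, hpl, -⟩ := hit i hi
    exact (Lmin i w p hwb.1).trans hpl
  have Lvert : ∀ i, ∀ v, ∀ p : G.Walk u v, ∀ m, m ≤ p.length → m < L i →
      r (p.getVert m) < (d : ℝ) ^ (3 * i) := by
    intro i v p m hm hmL
    by_contra! hge
    have := Lmin i _ (p.take m) hge
    rw [SimpleGraph.Walk.take_length] at this
    omega
  let T := hfin.toFinset
  have hT : ∀ i, i ∈ T ↔ i ∈ S := fun i => hfin.mem_toFinset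
  rw [Set.ncard_eq_toFinset_card S hfin]
  have hcard : T.card = ∑ k ∈ Finset.range (d + 1), (T.filter (fun i => L i = k)).card :=
    Finset.card_eq_sum_card_fiberwise (fun i hi => by
      have := Lle i ((hT i).1 hi)
      simp; omega)
  have hzero : (T.filter (fun i => L i = 0)).card ≤ 1 := by
    rw [Finset.card_le_one]
    have : ∀ i ∈ T.filter (fun i => L i = 0), i = 0 := by
      intro i hi
      rw [Finset.mem_filter, hT] at hi
      obtain ⟨v, p, hp, hv⟩ := Lspec i hi.1
      rw [hi.2] at hp
      have huv := SimpleGraph.Walk.eq_of_length_eq_zero hp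
      subst huv
      by_contra hne
      have h0 : 0 < i := lt_of_le_of_ne hi.1.1 (Ne.symm hne)
      have : (1 : ℝ) < (d : ℝ) ^ (3 * i) := one_lt_zpow₀ hd1 (by omega)
      linarith
    intro a ha b hb
    rw [this a ha, this b hb]
  have hlevel : ∀ k ∈ Finset.range d,
      (T.filter (fun i => L i = k + 1)).card ≤ 2 * (d - k) + 1 := by
    intro k hk
    rw [Finset.mem_range] at hk
    by_contra! hcon
    set U := T.filter (fun i => L i = k + 1) with hU
    have hUm : ∀ i ∈ U, i ∈ S ∧ L i = k + 1 := by
      intro i hi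
      rw [hU, Finset.mem_filter, hT] at hi
      exact hi
    have hUne : U.Nonempty := Finset.card_pos.1 (by omega)
    set top := U.max' hUne with htop
    have htU : top ∈ U := Finset.max'_mem _ _
    set U' := U.erase top with hU'
    have hU'c : U'.card = U.card - 1 := Finset.card_erase_of_mem htU
    have hU'ne : U'.Nonempty := Finset.card_pos.1 (by omega)
    set top' := U'.max' hU'ne with htop'
    have htU' : top' ∈ U' := Finset.max'_mem _ _
    have hlt : top' < top := lt_of_le_of_ne
      (Finset.le_max' U _ (Finset.mem_of_mem_erase htU')) (Finset.ne_of_mem_erase htU')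
    obtain ⟨v, pv, hpv, hv⟩ := Lspec top (hUm _ htU).1
    rw [(hUm _ htU).2] at hpv
    obtain ⟨w, hwb, p, hpl, hpr⟩ := hit top' (hUm _ (Finset.mem_of_mem_erase htU')).1
    have hnex : ∀ i ∈ U', ∃ n, (d : ℝ) ^ (3 * i) ≤ r (p.getVert n) := by
      intro i hi
      refine ⟨p.length, ?_⟩
      rw [p.getVert_length]
      refine le_trans (zpow_le_zpow_right₀ hd1.le ?_) hwb.1
      have := Finset.le_max' U' i hi
      omega
    let N : ℤ → ℕ := fun i => sInf {n | (d : ℝ) ^ (3 * i) ≤ r (p.getVert n)}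
    have Nspec : ∀ i ∈ U', (d : ℝ) ^ (3 * i) ≤ r (p.getVert (N i)) :=
      fun i hi => Nat.sInf_mem (hnex i hi)
    have Nlen : ∀ i ∈ U', N i ≤ p.length := by
      intro i hi
      by_contra! hgt
      have h1 := Nspec i hi
      rw [p.getVert_of_length_le hgt.le, ← p.getVert_length] at h1
      have : N i ≤ p.length := Nat.sInf_le h1
      omega
    have Nmin : ∀ i, ∀ m < N i, r (p.getVert m) ≤ (d : ℝ) ^ (3 * i) := by
      intro i m hm
      by_contra! hgt
      have : N i ≤ m := Nat.sInf_le hgt.le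
      omega
    have Nge : ∀ i ∈ U', k + 1 ≤ N i := by
      intro i hi
      by_contra! hlt'
      have h1 := Lvert i w p (N i) (Nlen i hi) (by
        rw [(hUm i (Finset.mem_of_mem_erase hi)).2]; exact hlt')
      exact absurd (Nspec i hi) (not_le.2 h1)
    obtain ⟨n, hn, hcn⟩ := Finset.exists_lt_card_fiber_of_mul_lt_card_of_maps_to
      (s := U') (t := Finset.Icc (k + 1) d) (f := N) (n := 2)
      (fun i hi => by
        rw [Finset.mem_Icc]
        exact ⟨Nge i hi, (Nlen i hi).trans hpl⟩)
      (by rw [Nat.card_Icc]; omega)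
    set F := U'.filter (fun i => N i = n) with hF
    have hFm : ∀ i ∈ F, i ∈ U' ∧ N i = n := fun i hi => by
      rwa [hF, Finset.mem_filter] at hi
    have three : ∃ i ∈ F, ∃ i' ∈ F, ∃ i'' ∈ F, i < i' ∧ i' < i'' := by
      let e := F.orderEmbOfFin rfl
      refine ⟨e ⟨0, by omega⟩, F.orderEmbOfFin_mem rfl _, e ⟨1, by omega⟩,
        F.orderEmbOfFin_mem rfl _, e ⟨2, by omega⟩, F.orderEmbOfFin_mem rfl _, ?_, ?_⟩
      · exact e.strictMono (by simp)
      · exact e.strictMono (by simp)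
    obtain ⟨i, hi, i', hi', i'', hi'', hii, hii'⟩ := three
    have hiU := Finset.mem_of_mem_erase (hFm i hi).1
    have hiU' := Finset.mem_of_mem_erase (hFm i' hi').1
    have hiU'' := Finset.mem_of_mem_erase (hFm i'' hi'').1
    obtain ⟨w₂, hw₂b, p₂, hp₂l, hp₂r⟩ := hit i' (hUm _ hiU').1
    have hXpos : (0 : ℝ) ≤ (d : ℝ) ^ (3 * i) := by positivity
    refine three_buckets hcm hcu hru p₂ d hd hp₂l hp₂r i i' i'' (hUm _ hiU).1.1 hii hii' hw₂b
      v (p.getVert n) ?_ ?_ ?_ ?_ ?_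
    · intro heq
      have h1 := hpr _ (p.getVert_mem_support n)
      rw [← heq] at h1
      have h2 : (d : ℝ) ^ (3 * top' + 3) ≤ (d : ℝ) ^ (3 * top) :=
        zpow_le_zpow_right₀ hd1.le (by omega)
      have h3 := hwb.2
      linarith
    · have h1 := walk_near hcm hcu pv _ hXpos pv.length le_rfl (fun m hm =>
        (Lvert i v pv m hm.le (by rw [(hUm i hiU).2]; omega)).le)
      rw [pv.getVert_length] at h1
      refine h1.trans ?_
      have : (pv.length : ℝ) ≤ d := by exact_mod_cast (by omega : pv.length ≤ d)
      gcongr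
    · have hNi := (hFm i hi).2
      have h1 := walk_near hcm hcu p _ hXpos (N i) (Nlen i (hFm i hi).1) (Nmin i)
      rw [hNi] at h1
      refine h1.trans ?_
      have : (n : ℝ) ≤ d := by exact_mod_cast (Finset.mem_Icc.1 hn).2
      gcongr
    · refine le_trans (zpow_le_zpow_right₀ hd1.le ?_) hv
      have := Finset.le_max' U i'' hiU''
      omega
    · have := Nspec i'' (hFm i'' hi'').1
      rwa [(hFm i'' hi'').2] at this
  have hsum : ∀ m : ℕ, ∑ k ∈ Finset.range m, (2 * (m - k) + 1) = m * (m + 2) := by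
    intro m
    induction m with
    | zero => simp
    | succ m ih =>
      rw [Finset.sum_range_succ']
      simp only [Nat.add_sub_add_right, ih]
      simp; ring
  change T.card ≤ _
  rw [hcard, Finset.sum_range_succ']
  have := Finset.sum_le_sum hlevel
  rw [hsum d] at this
  nlinarith
end

section
/- Let d > 12 be an integer, let G be a finite simple graph with coin model (c, r), let ⪯ be a Koebe ordering of G with respect to (c, r), and let u be a vertex with c(u) = 0 and r(u) = 1. Suppose that indices j and j' with j < j' are both accessible from some index i ≥ 0. Then for every integer t with i+2 ≤ t ≤ j−1, one has B_t ∩ WReach_d[u] = ∅. -/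
open Metric

/-- The index `j` is accessible from `i` (with respect to `u`): there is a path in `G`
starting at `u`, of length at most `d`, ending at a vertex `w ∈ B_j` with `w ⪯ u`, all
of whose vertices are `⪰ w` and belong to `B_j ∪ ⋃_{k ≤ i} B_k`. -/
def Accessible {V : Type*} [LinearOrder V] (G : SimpleGraph V) (r : V → ℝ) (d : ℕ)
    (u : V) (i j : ℤ) : Prop :=
  ∃ w ∈ bucket r d j, w ≤ u ∧ ∃ p : G.Walk u w, p.IsPath ∧ p.length ≤ d ∧
    (∀ x ∈ p.support, w ≤ x) ∧
    (∀ x ∈ p.support, x ∈ bucket r d j ∨ ∃ k : ℤ, k ≤ i ∧ x ∈ bucket r d k)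

lemma kj_walk {V : Type*} (G : SimpleGraph V)
    (c : V → EuclideanSpace ℝ (Fin 2)) (r : V → ℝ) (hcm : IsCoinModel G c r)
    (Q : V → Prop) (M : ℝ) (hM : 0 ≤ M) :
    ∀ {u w : V} (p : G.Walk u w), Q w → (∀ x ∈ p.support, Q x ∨ r x ≤ M) →
      ∃ x ∈ p.support, Q x ∧ dist (c u) (c x) ≤ r x - r u + 2 * M * p.length := by
  intro u w p
  induction p with
  | nil => intro hw _; exact ⟨_, by simp, hw, by simp⟩
  | @cons u v w h p ih =>
    intro hw hx
    by_cases hu : Q u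
    · refine ⟨u, by simp, hu, ?_⟩
      simp only [dist_self, sub_self, zero_add]
      positivity
    · obtain ⟨x, hxs, hQ, hd⟩ := ih hw (fun x hx' => hx x (by simp [hx']))
      refine ⟨x, by simp [hxs], hQ, ?_⟩
      have hu' : r u ≤ M := (hx u (by simp)).resolve_left hu
      obtain ⟨z, hz1, hz2⟩ := hcm.touch u v h
      rw [mem_closedBall] at hz1 hz2
      have h1 := dist_triangle (c u) (c v) (c x)
      have h2 := dist_triangle (c u) z (c v)
      rw [dist_comm (c u) z] at h2
      rw [SimpleGraph.Walk.length_cons]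
      push_cast
      linarith

lemma kj_shrink (c : EuclideanSpace ℝ (Fin 2)) (ρ R δ : ℝ) (hR : 0 ≤ R) (hδ : 0 ≤ δ)
    (hρ : R ≤ ρ) (hc : ‖c‖ ≤ ρ + δ) :
    ∃ c' : EuclideanSpace ℝ (Fin 2), ‖c'‖ ≤ R + δ ∧ dist c c' ≤ ρ - R := by
  by_cases h : ‖c‖ ≤ ρ - R
  · exact ⟨0, by simp; positivity, by simpa using h⟩
  · push Not at h
    have hpos : 0 < ‖c‖ := by linarith
    refine ⟨(1 - (ρ - R) / ‖c‖) • c, ?_, ?_⟩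
    · have : 0 ≤ 1 - (ρ - R) / ‖c‖ := by
        rw [sub_nonneg, div_le_one hpos]; exact h.le
      rw [norm_smul, Real.norm_of_nonneg this, sub_mul, div_mul_cancel₀ _ hpos.ne']
      linarith
    · have e : c - (1 - (ρ - R) / ‖c‖) • c = ((ρ - R) / ‖c‖) • c := by
        rw [sub_smul, one_smul, sub_sub_cancel]
      have : 0 ≤ (ρ - R) / ‖c‖ := div_nonneg (by linarith) hpos.le
      rw [dist_eq_norm, e, norm_smul, Real.norm_of_nonneg this, div_mul_cancel₀ _ hpos.ne']

lemma kj_geom (a b p : EuclideanSpace ℝ (Fin 2)) (m d : ℝ) (hm : 0 < m) (hd : 13 ≤ d)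
    (ha : ‖a‖ ≤ d ^ 5 * m + 2 * m) (hb : ‖b‖ ≤ d ^ 5 * m + 2 * m)
    (hp : ‖p‖ ≤ d ^ 2 * m + 2 * d ^ 3 * m)
    (hab : d ^ 5 * m + d ^ 5 * m ≤ dist a b)
    (hpa : d ^ 2 * m + d ^ 5 * m ≤ dist p a)
    (hpb : d ^ 2 * m + d ^ 5 * m ≤ dist p b) : False := by
  rw [dist_eq_norm] at hab hpa hpb
  have hd0 : 0 < d := by linarith
  have e1 := parallelogram_law_with_norm ℝ a b
  have e2 := norm_sub_sq_real p a
  have e3 := norm_sub_sq_real p b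
  have e4 : inner ℝ p a + inner ℝ p b = inner ℝ p (a + b) := (inner_add_right _ _ _).symm
  have e5 : -(‖p‖ * ‖a + b‖) ≤ inner ℝ p (a + b) := by
    have := abs_real_inner_le_norm p (a + b)
    exact (abs_le.mp this).1
  have a2 := pow_le_pow_left₀ (norm_nonneg a) ha 2
  have b2 := pow_le_pow_left₀ (norm_nonneg b) hb 2
  have p2 := pow_le_pow_left₀ (norm_nonneg p) hp 2
  have ab2 := pow_le_pow_left₀ (by positivity) hab 2
  have pa2 := pow_le_pow_left₀ (by positivity) hpa 2
  have pb2 := pow_le_pow_left₀ (by positivity) hpb 2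
  have d5 : 1 ≤ d ^ 5 := one_le_pow₀ (by linarith)
  have d6 : 13 * d ^ 5 ≤ d ^ 6 := by
    rw [pow_succ d 5]; nlinarith
  have d7 : 13 * d ^ 6 ≤ d ^ 7 := by
    rw [pow_succ d 6]; nlinarith [pow_pos hd0 6]
  have hs : ‖a + b‖ ≤ 4 * d ^ 3 * m := by
    apply (sq_le_sq₀ (norm_nonneg _) (by positivity)).1
    have : ‖a + b‖ ^ 2 ≤ (16 * d ^ 5 + 16) * m ^ 2 := by nlinarith
    have h2 : (16 * d ^ 5 + 16) * m ^ 2 ≤ (16 * d ^ 6) * m ^ 2 := by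
      gcongr; linarith
    calc _ ≤ _ := this
      _ ≤ _ := h2
      _ = _ := by ring
  have hps : ‖p‖ * ‖a + b‖ ≤ (d ^ 2 * m + 2 * d ^ 3 * m) * (4 * d ^ 3 * m) := by gcongr
  have key : 0 ≤ (12 * d ^ 6 + 12 * d ^ 5 + 4 - 2 * d ^ 7) * m ^ 2 := by linarith
  have : (12 * d ^ 6 + 12 * d ^ 5 + 4 - 2 * d ^ 7) < 0 := by linarith
  have hm2 : 0 < m ^ 2 := by positivity
  nlinarith

/-- If two indices `j < j'` are both accessible from `i ≥ 0`, then the buckets `B_t`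
for `i+2 ≤ t ≤ j−1` contain no vertex weakly `d`-reachable from `u`. -/
theorem koebe_jumps_empty (d : ℕ) (hd : 12 < d) (V : Type) [Fintype V] [LinearOrder V]
    (G : SimpleGraph V) (c : V → EuclideanSpace ℝ (Fin 2)) (r : V → ℝ)
    (hcm : IsCoinModel G c r) (hko : ∀ a b : V, r b < r a → a ≤ b)
    (u : V) (hcu : c u = 0) (hru : r u = 1)
    (i j j' : ℤ) (hi : 0 ≤ i) (hij : i < j) (hjj : j < j')
    (haj : Accessible G r d u i j) (haj' : Accessible G r d u i j') :
    ∀ t : ℤ, i + 2 ≤ t → t ≤ j - 1 → bucket r d t ∩ WReach G d u = ∅ := by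
  intro t ht1 ht2
  rw [Set.eq_empty_iff_forall_notMem]
  rintro v ⟨⟨hv1, hv2⟩, -, p, -, hpl, hpv⟩
  have hd13 : (13 : ℝ) ≤ d := by exact_mod_cast hd
  have hd1 : (1 : ℝ) ≤ d := by linarith
  have hd0 : (0 : ℝ) < d := by linarith
  set m : ℝ := (d : ℝ) ^ (3 * i + 4) with hm
  have hm0 : 0 < m := zpow_pos hd0 _
  have hmono : ∀ x y : ℤ, x ≤ y → (d : ℝ) ^ x ≤ (d : ℝ) ^ y :=
    fun x y h => zpow_le_zpow_right₀ hd1 h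
  have hm3 : (d : ℝ) ^ (3 * i + 3) * d = m := by
    rw [hm, ← zpow_add_one₀ hd0.ne']; congr 1; ring
  have hm6 : (d : ℝ) ^ 2 * m = (d : ℝ) ^ (3 * i + 6) := by
    rw [hm, ← zpow_natCast, ← zpow_add₀ hd0.ne']; congr 1; push_cast; ring
  have hm9 : (d : ℝ) ^ 5 * m = (d : ℝ) ^ (3 * i + 9) := by
    rw [hm, ← zpow_natCast, ← zpow_add₀ hd0.ne']; congr 1; push_cast; ring
  have acc : ∀ k : ℤ, j ≤ k → Accessible G r d u i k →
      ∃ x ∈ bucket r d k, ‖c x‖ ≤ r x + 2 * m := by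
    rintro k hk ⟨w, hw, -, q, -, hql, -, hq⟩
    obtain ⟨x, -, hx, hdist⟩ := kj_walk G c r hcm (fun x => x ∈ bucket r d k)
      ((d : ℝ) ^ (3 * i + 3)) (by positivity) q hw (by
        intro x hx
        rcases hq x hx with h | ⟨l, hl, h⟩
        · exact Or.inl h
        · exact Or.inr (h.2.le.trans (hmono _ _ (by omega))))
    refine ⟨x, hx, ?_⟩
    rw [hcu, dist_zero_left, hru] at hdist
    have hl : (q.length : ℝ) ≤ d := by exact_mod_cast hql
    have : (d : ℝ) ^ (3 * i + 3) * q.length ≤ (d : ℝ) ^ (3 * i + 3) * d := by gcongr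
    linarith
  obtain ⟨x, hx, hxd⟩ := acc j le_rfl haj
  obtain ⟨y, hy, hyd⟩ := acc j' hjj.le haj'
  obtain ⟨z, hzs, hz, hzd⟩ := kj_walk G c r hcm (fun x => (d : ℝ) ^ 2 * m ≤ r x)
    ((d : ℝ) ^ 2 * m) (by positivity) p
    (by rw [hm6]; exact (hmono _ _ (by omega)).trans hv1) (fun x _ => le_total _ _)
  have hzd' : ‖c z‖ ≤ r z + 2 * (d : ℝ) ^ 3 * m := by
    rw [hcu, dist_zero_left, hru] at hzd
    have hl : (p.length : ℝ) ≤ d := by exact_mod_cast hpl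
    have : (d : ℝ) ^ 2 * m * p.length ≤ (d : ℝ) ^ 2 * m * d := by gcongr
    have e : (d : ℝ) ^ 2 * m * d = (d : ℝ) ^ 3 * m := by ring
    linarith
  have hzv : r z ≤ r v := by
    by_contra h
    push Not at h
    have := le_antisymm (hko z v h) (hpv z hzs)
    rw [this] at h
    exact lt_irrefl _ h
  have hzx : r z < r x :=
    hzv.trans_lt (hv2.trans_le ((hmono _ _ (by omega)).trans hx.1))
  have hxy : r x < r y := hx.2.trans_le ((hmono _ _ (by omega)).trans hy.1)
  have sep : ∀ a b : V, r a < r b → r a + r b ≤ dist (c a) (c b) := by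
    intro a b h
    have hne : a ≠ b := by rintro rfl; exact lt_irrefl _ h
    exact (disjoint_ball_ball_iff (hcm.r_pos a) (hcm.r_pos b)).1 (hcm.disj a b hne)
  have hRx : (d : ℝ) ^ 5 * m ≤ r x := by
    rw [hm9]; exact (hmono _ _ (by omega)).trans hx.1
  obtain ⟨a, ha, ha'⟩ := kj_shrink (c x) (r x) ((d : ℝ) ^ 5 * m) (2 * m) (by positivity)
    (by positivity) hRx hxd
  obtain ⟨b, hb, hb'⟩ := kj_shrink (c y) (r y) ((d : ℝ) ^ 5 * m) (2 * m) (by positivity)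
    (by positivity) (hRx.trans hxy.le) hyd
  obtain ⟨q, hq, hq'⟩ := kj_shrink (c z) (r z) ((d : ℝ) ^ 2 * m) (2 * (d : ℝ) ^ 3 * m)
    (by positivity) (by positivity) hz hzd'
  have tri : ∀ A B A' B' : EuclideanSpace ℝ (Fin 2),
      dist A B ≤ dist A A' + dist A' B' + dist B B' := by
    intro A B A' B'
    have := dist_triangle4 A A' B' B
    rwa [dist_comm B' B] at this
  have s1 := sep x y hxy
  have s2 := sep z x hzx
  have s3 := sep z y (hzx.trans hxy)
  have t1 := tri (c x) (c y) a b
  have t2 := tri (c z) (c x) q a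
  have t3 := tri (c z) (c y) q b
  exact kj_geom a b q m d hm0 hd13 ha hb hq (by linarith) (by linarith) (by linarith)
end

section
/- Let d ≥ 1 be an integer and let G be the d×d grid graph: its vertex set is {1,…,d} × {1,…,d}, with two vertices adjacent if and only if they agree in one coordinate and differ by exactly 1 in the other. Then for every linear order ⪯ on the vertex set of G there exists a vertex u with |SReach_{3d−2}[u]| ≥ d/2. -/
/-- The `d × d` grid graph on `Fin d × Fin d`: two vertices are adjacent iff they agree
in one coordinate and differ by exactly `1` in the other. -/
def gridGraph (d : ℕ) : SimpleGraph (Fin d × Fin d) :=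
  SimpleGraph.fromRel fun a b =>
    (a.1 = b.1 ∧ (a.2 : ℕ) + 1 = (b.2 : ℕ)) ∨ (a.2 = b.2 ∧ (a.1 : ℕ) + 1 = (b.1 : ℕ))

/-- The set of vertices strongly `d`-reachable from `u` with respect to the order
relation `le`: vertices `w ⪯ u` joined to `u` by a path of length at most `d` all of
whose internal vertices are strictly `≻ u`. -/
def SReach {V : Type*} (G : SimpleGraph V) (le : V → V → Prop) (d : ℕ) (u : V) :
    Set V :=
  {w | le w u ∧ ∃ p : G.Walk u w, p.IsPath ∧ p.length ≤ d ∧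
    ∀ x ∈ p.support, x ≠ u → x ≠ w → (le u x ∧ x ≠ u)}

/-- Walking along a line. -/
theorem line_walk {V : Type*} (G : SimpleGraph V) {d : ℕ} (f : Fin d → V)
    (hf : ∀ a b : Fin d, (a : ℕ) + 1 = b → G.Adj (f a) (f b)) (a b : Fin d) :
    ∃ p : G.Walk (f a) (f b), p.length ≤ d - 1 ∧ ∀ x ∈ p.support, ∃ c, x = f c := by
  have key : ∀ n : ℕ, ∀ a b : Fin d, (a : ℕ) + n = b →
      ∃ p : G.Walk (f a) (f b), p.length = n ∧ ∀ x ∈ p.support, ∃ c, x = f c := by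
    intro n
    induction n with
    | zero =>
      intro a b h
      obtain rfl : a = b := Fin.ext (by omega)
      exact ⟨SimpleGraph.Walk.nil, rfl, fun x hx => ⟨a, by simpa using hx⟩⟩
    | succ n ih =>
      intro a b h
      have hb := b.2
      obtain ⟨p, hp, hs⟩ := ih ⟨a + 1, by omega⟩ b (by simp only; omega)
      refine ⟨SimpleGraph.Walk.cons (hf a ⟨a + 1, by omega⟩ rfl) p, by simp [hp], ?_⟩
      intro x hx
      rw [SimpleGraph.Walk.support_cons, List.mem_cons] at hx
      rcases hx with rfl | hx
      · exact ⟨a, rfl⟩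
      · exact hs x hx
  have ha := a.2
  have hb := b.2
  rcases le_total (a : ℕ) b with h | h
  · obtain ⟨p, hp, hs⟩ := key (b - a) a b (by omega)
    exact ⟨p, by omega, hs⟩
  · obtain ⟨p, hp, hs⟩ := key (a - b) b a (by omega)
    exact ⟨p.reverse, by rw [SimpleGraph.Walk.length_reverse]; omega, by simpa using hs⟩

/-- Cut a walk at the first vertex violating `B`. -/
theorem first_bad {V : Type*} (G : SimpleGraph V) (B : V → Prop) {u v : V}
    (p : G.Walk u v) (hv : ¬ B v) :
    ∃ w ∈ p.support, ¬ B w ∧ ∃ q : G.Walk u w, q.length ≤ p.length ∧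
      ∀ x ∈ q.support, x ≠ w → B x := by
  induction p with
  | nil => exact ⟨_, by simp, hv, SimpleGraph.Walk.nil, by simp, by simp⟩
  | @cons u v' w' h p ih =>
    by_cases hu : B u
    · obtain ⟨w, hw, hbw, q, hq, hs⟩ := ih hv
      refine ⟨w, by simp [hw], hbw, SimpleGraph.Walk.cons h q, by simpa using hq, ?_⟩
      intro x hx hxw
      rw [SimpleGraph.Walk.support_cons, List.mem_cons] at hx
      rcases hx with rfl | hx
      · exact hu
      · exact hs x hx hxw
    · exact ⟨u, by simp, hu, SimpleGraph.Walk.nil, by simp, by simp⟩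

theorem line_case {V : Type*} [LinearOrder V] [Finite V] (G : SimpleGraph V) {d : ℕ}
    (e : Fin d → Fin d → V)
    (he : ∀ i j i' j', e i j = e i' j' → i = i' ∧ j = j')
    (h1 : ∀ i, ∀ a b : Fin d, (a : ℕ) + 1 = b → G.Adj (e i a) (e i b))
    (h2 : ∀ j, ∀ a b : Fin d, (a : ℕ) + 1 = b → G.Adj (e a j) (e b j))
    (u : V) (i j0 : Fin d) (hu : u = e i j0) (hrow : ∀ j, u ≤ e i j)
    (hcol : ∀ j, ∃ k, ¬ u < e k j) :
    d ≤ (SReach G (fun x y => x ≤ y) (3 * d - 2) u).ncard := by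
  classical
  have hd : 1 ≤ d := by have := i.2; omega
  have key : ∀ j, ∃ k, e k j ∈ SReach G (fun x y => x ≤ y) (3 * d - 2) u := by
    intro j
    by_cases hj : j = j0
    · subst hj
      refine ⟨i, ?_⟩
      rw [← hu]
      exact ⟨le_refl u, SimpleGraph.Walk.nil, by simp, by simp, by simp⟩
    · obtain ⟨k, hk⟩ := hcol j
      obtain ⟨p, hp, hps⟩ := line_walk G (fun a => e i a) (h1 i) j0 j
      obtain ⟨q, hq, hqs⟩ := line_walk G (fun a => e a j) (h2 j) i k
      have hkj : ¬ u ≤ e k j := by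
        intro h
        apply hk
        refine lt_of_le_of_ne h ?_
        intro h'
        exact hj (he _ _ _ _ (hu.symm.trans h')).2.symm
      obtain ⟨w, hw, hbw, r, hr, hrs⟩ := first_bad G (fun x => u ≤ x) (p.append q) hkj
      rw [SimpleGraph.Walk.mem_support_append_iff] at hw
      rcases hw with hw | hw
      · obtain ⟨c, rfl⟩ := hps w hw
        exact absurd (hrow c) hbw
      · obtain ⟨c, rfl⟩ := hqs w hw
        refine ⟨c, (not_le.mp hbw).le, ?_⟩
        subst hu
        refine ⟨r.bypass, r.bypass_isPath, ?_, ?_⟩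
        · have := r.length_bypass_le_length
          rw [SimpleGraph.Walk.length_append] at hr
          omega
        · intro x hx hxu hxw
          exact ⟨hrs x (r.support_bypass_subset_support hx) hxw, hxu⟩
  choose k hk using key
  have hinj : Function.Injective (fun j => e (k j) j) := fun a b hab => (he _ _ _ _ hab).2
  have hsub : Set.range (fun j => e (k j) j) ⊆ SReach G (fun x y => x ≤ y) (3 * d - 2) u := by
    rintro _ ⟨j, rfl⟩
    exact hk j
  have := Set.ncard_le_ncard hsub (Set.toFinite _)
  rwa [← Set.image_univ, Set.ncard_image_of_injective _ hinj, Set.ncard_univ,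
    Nat.card_eq_fintype_card, Fintype.card_fin] at this

theorem grid_abstract {V : Type*} [LinearOrder V] [Finite V] (G : SimpleGraph V) {d : ℕ}
    (hd : 1 ≤ d) (e : Fin d → Fin d → V)
    (he : ∀ i j i' j', e i j = e i' j' → i = i' ∧ j = j')
    (h1 : ∀ i, ∀ a b : Fin d, (a : ℕ) + 1 = b → G.Adj (e i a) (e i b))
    (h2 : ∀ j, ∀ a b : Fin d, (a : ℕ) + 1 = b → G.Adj (e a j) (e b j)) :
    ∃ u, d ≤ (SReach G (fun x y => x ≤ y) (3 * d - 2) u).ncard := by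
  have : Nonempty (Fin d) := ⟨⟨0, hd⟩⟩
  have : Nonempty V := ⟨e ⟨0, hd⟩ ⟨0, hd⟩⟩
  let P : Set V := {u | (∃ i, ∀ j, u ≤ e i j) ∨ (∃ j, ∀ i, u ≤ e i j)}
  obtain ⟨m, hm⟩ := Finite.exists_min (id : V → V)
  have hmP : m ∈ P := Or.inl ⟨⟨0, hd⟩, fun j => hm _⟩
  obtain ⟨u, huP, hmax⟩ := Set.exists_max_image P id (Set.toFinite _) ⟨m, hmP⟩
  have hrow : ∀ i, ∃ j, ¬ u < e i j := by
    intro i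
    obtain ⟨j, hj⟩ := Finite.exists_min (fun j => e i j)
    exact ⟨j, not_lt.mpr (hmax _ (Or.inl ⟨i, hj⟩))⟩
  have hcol : ∀ j, ∃ i, ¬ u < e i j := by
    intro j
    obtain ⟨i, hi⟩ := Finite.exists_min (fun i => e i j)
    exact ⟨i, not_lt.mpr (hmax _ (Or.inr ⟨j, hi⟩))⟩
  refine ⟨u, ?_⟩
  rcases huP with ⟨i, hi⟩ | ⟨j, hj⟩
  · obtain ⟨j0, hj0⟩ := hrow i
    exact line_case G e he h1 h2 u i j0 (le_antisymm (hi j0) (not_lt.mp hj0)) hi hcol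
  · obtain ⟨i0, hi0⟩ := hcol j
    exact line_case G (fun a b => e b a) (fun a b a' b' h => (he _ _ _ _ h).symm) h2 h1 u j i0
      (le_antisymm (hj i0) (not_lt.mp hi0)) hj hrow

/-- The bundled linear order given by a relation. -/
noncomputable def mkLO {V : Type*} (le : V → V → Prop) (hlin : IsLinearOrder V le) :
    LinearOrder V :=
  { le := le
    le_refl := hlin.refl
    le_trans := hlin.trans
    le_antisymm := hlin.antisymm
    le_total := hlin.total
    toDecidableLE := Classical.decRel _ }

/-- For every linear ordering of the `d × d` grid there is a vertex strongly
`(3d−2)`-reaching at least `d/2` vertices. -/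
theorem grid_sreach_lower_bound (d : ℕ) (hd : 1 ≤ d)
    (le : Fin d × Fin d → Fin d × Fin d → Prop)
    (hlin : IsLinearOrder (Fin d × Fin d) le) :
    ∃ u : Fin d × Fin d,
      (d : ℝ) / 2 ≤ ((SReach (gridGraph d) le (3 * d - 2) u).ncard : ℝ) := by
  classical
  obtain ⟨u, hu⟩ := @grid_abstract (Fin d × Fin d) (mkLO le hlin) _ (gridGraph d) d hd (fun i j => (i, j))
    (fun i j i' j' h => Prod.mk.inj h)
    (fun i a b h => by
      refine (SimpleGraph.fromRel_adj _ _ _).2 ⟨?_, Or.inl (Or.inl ⟨rfl, h⟩)⟩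
      intro h'
      have := congrArg (fun x => (x.2 : ℕ)) h'
      simp only at this
      omega)
    (fun j a b h => by
      refine (SimpleGraph.fromRel_adj _ _ _).2 ⟨?_, Or.inl (Or.inr ⟨rfl, h⟩)⟩
      intro h'
      have := congrArg (fun x => (x.1 : ℕ)) h'
      simp only at this
      omega)
  refine ⟨u, ?_⟩
  have h : (d : ℝ) ≤ ((SReach (gridGraph d) le (3 * d - 2) u).ncard : ℝ) := by
    exact_mod_cast hu
  have h0 : (0 : ℝ) ≤ d := Nat.cast_nonneg d
  linarith
end
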